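/- Let n ≥ 1, a ∈ L^∞S^{-n}_0, 0 < θ_1 < n/2, ε > 0, and let N > n be a positive integer. There is a constant C (depending on these parameters and finitely many seminorms of a) such that for every l ≥ 1, every positive integer j, every x_0 ∈ ℝⁿ, and every Schwartz function u: |Q(x_0,l)|^{-1} ∫_{Q(x_0,l)} |T_j^* u(x)| dx ≤ C (2^{−jn/2 + jθ_1 + jεn} + 2^{−jε(N−n)} l^{−(N−n)}) Mu(x_0). -/

import Mathlib

open MeasureTheory Real
open scoped ENNReal NNReal InnerProductSpace BigOperators

noncomputable section

/-- `ℝⁿ` with its Euclidean structure. -/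
abbrev Rn (n : ℕ) : Type := EuclideanSpace ℝ (Fin n)

/-- The Fourier transform `û(ξ) = ∫ e^{-i⟨x,ξ⟩} u(x) dx`. -/
def ft {n : ℕ} (u : Rn n → ℂ) (ξ : Rn n) : ℂ :=
  ∫ x : Rn n, Complex.exp (-(Complex.I * ((⟪x, ξ⟫_ℝ : ℝ) : ℂ))) * u x

/-- The pseudo-differential operator `T_a u(x) = ∫ e^{i⟨x,ξ⟩} a(x,ξ) û(ξ) dξ`. -/
def pdo {n : ℕ} (a : Rn n → Rn n → ℂ) (u : Rn n → ℂ) (x : Rn n) : ℂ :=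
  ∫ ξ : Rn n, Complex.exp (Complex.I * ((⟪x, ξ⟫_ℝ : ℝ) : ℂ)) * a x ξ * ft u ξ

/-- The dual operator `T_a^* u(x) = ∫∫ e^{i⟨x-y,ξ⟩} a(y,ξ) dξ u(y) dy`. -/
def pdoDual {n : ℕ} (a : Rn n → Rn n → ℂ) (u : Rn n → ℂ) (x : Rn n) : ℂ :=
  ∫ y : Rn n,
    (∫ ξ : Rn n, Complex.exp (Complex.I * ((⟪x - y, ξ⟫_ℝ : ℝ) : ℂ)) * a y ξ) * u y

/-- The Hörmander symbol class `S^m_{ϱ,δ}`: `a` is smooth and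
`|∂^β_x ∂^α_ξ a(x,ξ)| ≤ C_{α,β} (1+|ξ|²)^{(m-ϱ|α|+δ|β|)/2}`. -/
def HormClass {n : ℕ} (m ϱ δ : ℝ) (a : Rn n → Rn n → ℂ) : Prop :=
  ContDiff ℝ (⊤ : ℕ∞) (Function.uncurry a) ∧
  ∀ k l : ℕ, ∃ C : ℝ, 0 < C ∧ ∀ x ξ : Rn n,
    ‖iteratedFDeriv ℝ l (fun y : Rn n => iteratedFDeriv ℝ k (fun η : Rn n => a y η) ξ) x‖ ≤
      C * (1 + ‖ξ‖ ^ 2) ^ ((m - ϱ * k + δ * l) / 2)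

/-- The rough Hörmander class `L^∞S^m_ϱ`: `a(x,ξ)` is smooth in `ξ`, bounded measurable in `x`,
and `‖∂^α_ξ a(·,ξ)‖_{L^∞} ≤ C_α (1+|ξ|²)^{(m-ϱ|α|)/2}`. -/
def RoughClass {n : ℕ} (m ϱ : ℝ) (a : Rn n → Rn n → ℂ) : Prop :=
  (∀ x : Rn n, ContDiff ℝ (⊤ : ℕ∞) (a x)) ∧
  (∀ ξ : Rn n, Measurable fun x : Rn n => a x ξ) ∧
  ∀ k : ℕ, ∃ C : ℝ, 0 < C ∧ ∀ ξ : Rn n, ∀ᵐ x : Rn n ∂volume,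
    ‖iteratedFDeriv ℝ k (a x) ξ‖ ≤ C * (1 + ‖ξ‖ ^ 2) ^ ((m - ϱ * k) / 2)

/-- The axis-parallel cube centered at `x₀` with side length `l`. -/
def cube {n : ℕ} (x₀ : Rn n) (l : ℝ) : Set (Rn n) :=
  {y | ∀ i, |y i - x₀ i| ≤ l / 2}

/-- The Hardy–Littlewood maximal function over axis-parallel cubes. -/
def mHL {n : ℕ} {E : Type*} [NormedAddCommGroup E] (u : Rn n → E) (x : Rn n) : ℝ≥0∞ :=
  ⨆ (x₀ : Rn n) (l : ℝ) (_ : 0 < l) (_ : x ∈ cube x₀ l),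
    (∫⁻ y in cube x₀ l, (‖u y‖₊ : ℝ≥0∞)) / ENNReal.ofReal (l ^ n)

/-- The Fefferman–Stein sharp maximal function over axis-parallel cubes. -/
def mSharp {n : ℕ} (u : Rn n → ℂ) (x : Rn n) : ℝ≥0∞ :=
  ⨆ (x₀ : Rn n) (l : ℝ) (_ : 0 < l) (_ : x ∈ cube x₀ l),
    ⨅ c : ℂ, (∫⁻ y in cube x₀ l, (‖u y - c‖₊ : ℝ≥0∞)) / ENNReal.ofReal (l ^ n)

/-- The Muckenhoupt `A₁` condition: `Mω ≤ C ω` a.e. -/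
def IsA1 {n : ℕ} (ω : Rn n → ℝ) : Prop :=
  (∀ x, 0 ≤ ω x) ∧ LocallyIntegrable ω volume ∧
  ∃ C : ℝ, 0 < C ∧ ∀ᵐ x : Rn n ∂volume, mHL ω x ≤ ENNReal.ofReal (C * ω x)

/-- The Muckenhoupt `A_p` condition for `1 < p < ∞`. -/
def IsAp {n : ℕ} (p : ℝ) (ω : Rn n → ℝ) : Prop :=
  (∀ x, 0 ≤ ω x) ∧ LocallyIntegrable ω volume ∧
  ∃ C : ℝ, 0 < C ∧ ∀ (x₀ : Rn n) (l : ℝ), 0 < l →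
    ((∫⁻ y in cube x₀ l, ENNReal.ofReal (ω y)) / ENNReal.ofReal (l ^ n)) *
      (((∫⁻ y in cube x₀ l, ENNReal.ofReal (ω y ^ (1 / (1 - p)))) /
          ENNReal.ofReal (l ^ n)) ^ (p - 1))
      ≤ ENNReal.ofReal C

/-- The weighted measure `ω(s) = ∫_s ω dx`. -/
def wMeas {n : ℕ} (ω : Rn n → ℝ) (s : Set (Rn n)) : ℝ≥0∞ :=
  ∫⁻ x in s, ENNReal.ofReal (ω x)

/-- The weighted `L¹` norm `∫ |u| ω dx`. -/
def wL1 {n : ℕ} (ω : Rn n → ℝ) (u : Rn n → ℂ) : ℝ≥0∞ :=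
  ∫⁻ x : Rn n, (‖u x‖₊ : ℝ≥0∞) * ENNReal.ofReal (ω x)

/-- The weighted `L^p` norm `(∫ |u|^p ω dx)^{1/p}`. -/
def wLp {n : ℕ} (p : ℝ) (ω : Rn n → ℝ) (u : Rn n → ℂ) : ℝ≥0∞ :=
  (∫⁻ x : Rn n, (‖u x‖₊ : ℝ≥0∞) ^ p * ENNReal.ofReal (ω x)) ^ (1 / p)

/-- A Littlewood–Paley cut-off: `ψ ∈ C_c^∞`, `0 ≤ ψ ≤ 1`, supported in the annulus
`{C₀⁻¹ ≤ |ξ| ≤ 2C₀}`. -/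
def LPcut {n : ℕ} (C₀ : ℝ) (ψ : Rn n → ℝ) : Prop :=
  ContDiff ℝ (⊤ : ℕ∞) ψ ∧ HasCompactSupport ψ ∧ (∀ ξ, 0 ≤ ψ ξ) ∧ (∀ ξ, ψ ξ ≤ 1) ∧
  tsupport ψ ⊆ {ξ : Rn n | C₀⁻¹ ≤ ‖ξ‖ ∧ ‖ξ‖ ≤ 2 * C₀}

/-- `K_j(x,y) = (2π)^{-n} ∫ e^{i⟨x-y,ξ⟩} a(x,ξ) ψ(2^{-j}ξ) dξ`. -/
def Kj {n : ℕ} (a : Rn n → Rn n → ℂ) (ψ : Rn n → ℝ) (j : ℕ) (x y : Rn n) : ℂ :=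
  ((((2 * π) ^ n)⁻¹ : ℝ) : ℂ) *
    ∫ ξ : Rn n, Complex.exp (Complex.I * ((⟪x - y, ξ⟫_ℝ : ℝ) : ℂ)) * a x ξ *
      ((ψ ((((2 : ℝ) ^ j)⁻¹) • ξ) : ℝ) : ℂ)

/-- `K_j^*(x,y) = (2π)^{-n} ∫ e^{i⟨x-y,ξ⟩} a(y,ξ) ψ(2^{-j}ξ) dξ`. -/
def KjStar {n : ℕ} (a : Rn n → Rn n → ℂ) (ψ : Rn n → ℝ) (j : ℕ) (x y : Rn n) : ℂ :=
  ((((2 * π) ^ n)⁻¹ : ℝ) : ℂ) *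
    ∫ ξ : Rn n, Complex.exp (Complex.I * ((⟪x - y, ξ⟫_ℝ : ℝ) : ℂ)) * a y ξ *
      ((ψ ((((2 : ℝ) ^ j)⁻¹) • ξ) : ℝ) : ℂ)

/-- `T_j u(x) = ∫ K_j(x,y) u(y) dy`. -/
def Tj {n : ℕ} (a : Rn n → Rn n → ℂ) (ψ : Rn n → ℝ) (j : ℕ) (u : Rn n → ℂ) (x : Rn n) : ℂ :=
  ∫ y : Rn n, Kj a ψ j x y * u y

/-- `T_j^* u(x) = ∫ K_j^*(x,y) u(y) dy`. -/
def TjStar {n : ℕ} (a : Rn n → Rn n → ℂ) (ψ : Rn n → ℝ) (j : ℕ) (u : Rn n → ℂ) (x : Rn n) : ℂ :=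
  ∫ y : Rn n, KjStar a ψ j x y * u y

/-- The Fourier integral operator `T_{a,φ} u(x) = ∫ e^{iφ(x,ξ)} a(x,ξ) û(ξ) dξ`. -/
def fio {n : ℕ} (a : Rn n → Rn n → ℂ) (φ : Rn n → Rn n → ℝ) (u : Rn n → ℂ) (x : Rn n) : ℂ :=
  ∫ ξ : Rn n, Complex.exp (Complex.I * ((φ x ξ : ℝ) : ℂ)) * a x ξ * ft u ξ

/-- The dual FIO `T^*_{a,φ} u(x) = ∫∫ e^{i(φ(y,ξ)-⟨x,ξ⟩)} a(y,ξ) dξ u(y) dy`. -/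
def fioDual {n : ℕ} (a : Rn n → Rn n → ℂ) (φ : Rn n → Rn n → ℝ) (u : Rn n → ℂ) (x : Rn n) : ℂ :=
  ∫ y : Rn n,
    (∫ ξ : Rn n, Complex.exp (Complex.I * ((φ y ξ - ⟪x, ξ⟫_ℝ : ℝ) : ℂ)) * a y ξ) * u y

/-- The phase class `Φ¹`: smooth on `ℝⁿ × (ℝⁿ∖{0})`, positively homogeneous of degree 1 in `ξ`,
with `sup |ξ|^{-1+|α|} |∂^α_ξ ∂^β_x φ| ≤ C_{α,β}` for `|α|+|β| ≥ 1`. -/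
def Phi1 {n : ℕ} (φ : Rn n → Rn n → ℝ) : Prop :=
  ContDiffOn ℝ (⊤ : ℕ∞) (Function.uncurry φ) {p : Rn n × Rn n | p.2 ≠ 0} ∧
  (∀ x : Rn n, ∀ ξ : Rn n, ξ ≠ 0 → ∀ t : ℝ, 0 < t → φ x (t • ξ) = t * φ x ξ) ∧
  ∀ k l : ℕ, 1 ≤ k + l → ∃ C : ℝ, 0 < C ∧ ∀ x ξ : Rn n, ξ ≠ 0 →
    ‖ξ‖ ^ ((k : ℝ) - 1) *
        ‖iteratedFDeriv ℝ k (fun η : Rn n => iteratedFDeriv ℝ l (fun y : Rn n => φ y η) x) ξ‖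
      ≤ C

/-- The rough phase class `L^∞Φ¹`: positively homogeneous of degree 1 in `ξ`, smooth in `ξ` away
from the origin, bounded measurable in `x`, with `sup |ξ|^{-1+|α|} ‖∂^α_ξ φ(·,ξ)‖_{L^∞} ≤ C_α`
for `|α| ≥ 1`. -/
def LinfPhi1 {n : ℕ} (φ : Rn n → Rn n → ℝ) : Prop :=
  (∀ x : Rn n, ContDiffOn ℝ (⊤ : ℕ∞) (φ x) {ξ : Rn n | ξ ≠ 0}) ∧
  (∀ ξ : Rn n, Measurable fun x : Rn n => φ x ξ) ∧
  (∀ ξ : Rn n, ∃ C : ℝ, ∀ x : Rn n, |φ x ξ| ≤ C) ∧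
  (∀ x : Rn n, ∀ ξ : Rn n, ξ ≠ 0 → ∀ t : ℝ, 0 < t → φ x (t • ξ) = t * φ x ξ) ∧
  ∀ k : ℕ, 1 ≤ k → ∃ C : ℝ, 0 < C ∧ ∀ ξ : Rn n, ξ ≠ 0 → ∀ᵐ x : Rn n ∂volume,
    ‖ξ‖ ^ ((k : ℝ) - 1) * ‖iteratedFDeriv ℝ k (φ x) ξ‖ ≤ C

open SchwartzMap FourierTransform LineDeriv in
/-- Differentiating `M` times in a fixed direction multiplies the size of the Fourier transform by
the `M`-th power of the corresponding frequency. -/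
theorem norm_fourier_iteratedLineDeriv_const {V : Type*} [NormedAddCommGroup V]
    [InnerProductSpace ℝ V] [FiniteDimensional ℝ V] [MeasurableSpace V] [BorelSpace V]
    (f : SchwartzMap V ℂ) (m : V) (M : ℕ) (w : V) :
    ‖𝓕 (∂^{fun _ : Fin M => m} f) w‖ = |⟪(2 * π) • w, m⟫_ℝ| ^ M * ‖𝓕 f w‖ := by
  induction M with
  | zero => simp
  | succ M ih =>
    have hg : (inner ℝ · m : V → ℝ).HasTemperateGrowth := by fun_prop
    rw [iteratedLineDerivOp_succ_left, fourier_lineDerivOp_eq]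
    have htail : (Fin.tail fun _ : Fin (M + 1) => m) = fun _ : Fin M => m := rfl
    rw [htail, smul_apply, smulLeftCLM_apply_apply hg, norm_smul, norm_smul, ih]
    rw [real_inner_smul_left, abs_mul, abs_of_pos (by positivity : (0 : ℝ) < 2 * π)]
    simp only [norm_mul, Complex.norm_I, Complex.norm_real, Real.norm_eq_abs,
      abs_of_pos Real.pi_pos, RCLike.norm_ofNat, mul_one]
    ring

open SchwartzMap FourierTransform in
/-- Plancherel bound for a Schwartz function which is bounded by `A` and supported in a ball. -/
theorem lintegral_sq_fourier_le {n : ℕ} (g : SchwartzMap (Rn n) ℂ) {A R : ℝ} (hR : 0 ≤ R)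
    (hA : ∀ ξ, ‖g ξ‖ ≤ A) (hs : ∀ ξ, R < ‖ξ‖ → g ξ = 0) :
    ∫⁻ w, ENNReal.ofReal (‖𝓕 g w‖ ^ 2) ≤
      ENNReal.ofReal (A ^ 2 * R ^ n) * volume (Metric.ball (0 : Rn n) 1) := by
  have hint (h : SchwartzMap (Rn n) ℂ) : Integrable (fun x => ‖h x‖ ^ 2) :=
    (h.memLp 2 volume).integrable_norm_pow (by norm_num)
  rw [← ofReal_integral_eq_lintegral_ofReal (hint _) (.of_forall fun _ => by positivity),
    integral_norm_sq_fourier,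
    ofReal_integral_eq_lintegral_ofReal (hint _) (.of_forall fun _ => by positivity)]
  calc ∫⁻ x, ENNReal.ofReal (‖g x‖ ^ 2)
      ≤ ∫⁻ x, (Metric.closedBall (0 : Rn n) R).indicator (fun _ => ENNReal.ofReal (A ^ 2)) x := by
        refine lintegral_mono fun x => ?_
        by_cases hx : x ∈ Metric.closedBall (0 : Rn n) R
        · rw [Set.indicator_of_mem hx]
          exact ENNReal.ofReal_le_ofReal (pow_le_pow_left₀ (norm_nonneg _) (hA x) 2)
        · rw [hs x (by simpa using hx)]
          simp
    _ = _ := by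
        rw [lintegral_indicator_const Metric.isClosed_closedBall.measurableSet,
          Measure.addHaar_closedBall _ _ hR, finrank_euclideanSpace_fin, ← mul_assoc,
          ← ENNReal.ofReal_mul (by positivity)]

/-- Powers of `1 + ‖z‖` are controlled by the powers of the coordinates. -/
theorem one_add_norm_pow_le {n : ℕ} (hn : 1 ≤ n) (K : ℕ) (z : Rn n) :
    (1 + ‖z‖) ^ (K + 1) ≤
      2 ^ K * (1 + (n : ℝ) ^ K * ∑ i, |⟪z, EuclideanSpace.single i 1⟫_ℝ| ^ (K + 1)) := by
  have h1 : ‖z‖ ≤ ∑ i, |⟪z, EuclideanSpace.single i 1⟫_ℝ| := by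
    rw [EuclideanSpace.norm_eq, Real.sqrt_le_left (Finset.sum_nonneg fun _ _ => abs_nonneg _)]
    refine le_trans (le_of_eq ?_)
      (Finset.sum_sq_le_sq_sum_of_nonneg fun _ _ => abs_nonneg _)
    refine Finset.sum_congr rfl fun i _ => ?_
    simp [EuclideanSpace.inner_single_right]
  have h2 : (∑ i, |⟪z, EuclideanSpace.single i 1⟫_ℝ|) ^ (K + 1) ≤
      (n : ℝ) ^ K * ∑ i, |⟪z, EuclideanSpace.single i 1⟫_ℝ| ^ (K + 1) := by
    have h := _root_.pow_sum_div_card_le_sum_pow (s := Finset.univ)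
      (f := fun i : Fin n => |⟪z, EuclideanSpace.single i 1⟫_ℝ|) (fun _ _ => abs_nonneg _) K
    rw [Finset.card_univ, Fintype.card_fin, div_le_iff₀ (by positivity)] at h
    linarith
  calc (1 + ‖z‖) ^ (K + 1) ≤ (1 + ∑ i, |⟪z, EuclideanSpace.single i 1⟫_ℝ|) ^ (K + 1) := by
        gcongr
    _ ≤ 2 ^ K * (1 ^ (K + 1) + (∑ i, |⟪z, EuclideanSpace.single i 1⟫_ℝ|) ^ (K + 1)) :=
        add_pow_le zero_le_one (Finset.sum_nonneg fun _ _ => abs_nonneg _) (K + 1)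
    _ ≤ _ := by rw [one_pow]; gcongr

open SchwartzMap FourierTransform LineDeriv in
/-- Weighted `L¹` bound for the Fourier transform of a Schwartz function supported in a ball of
radius `R`, in terms of `λ ≥ A R^{n/2}` where `A` bounds the function and its derivatives. -/
theorem exists_lintegral_weight_fourier_le {n : ℕ} (hn : 1 ≤ n) :
    ∃ c : ℝ≥0, ∀ (f : SchwartzMap (Rn n) ℂ) (A R s : ℝ), 0 ≤ R → 0 < s →
      A ^ 2 * R ^ n ≤ s ^ 2 → (∀ ξ, ‖f ξ‖ ≤ A) →
      (∀ ξ, ‖iteratedFDeriv ℝ (2 * (n + 1)) f ξ‖ ≤ A) →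
      (∀ ξ, R < ‖ξ‖ → f ξ = 0) →
      (∀ ξ, R < ‖ξ‖ → iteratedFDeriv ℝ (2 * (n + 1)) f ξ = 0) →
      ∫⁻ w, ENNReal.ofReal ((1 + ‖(2 * π) • w‖) ^ (n + 1) * ‖𝓕 f w‖) ≤ c * ENNReal.ofReal s := by
  set M := 2 * (n + 1) with hM
  set v := volume (Metric.ball (0 : Rn n) 1) with hv
  have hvt : v ≠ ∞ := measure_ball_lt_top.ne
  set J : ℝ≥0∞ := ∫⁻ w : Rn n, ENNReal.ofReal ((1 + ‖w‖) ^ (-(M : ℝ))) with hJ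
  have hJt : J ≠ ∞ := by
    refine (finite_integral_one_add_norm ?_).ne
    rw [finrank_euclideanSpace_fin, hM]
    push_cast
    linarith
  set B : ℝ≥0 := Real.toNNReal (2 ^ (2 * M - 1) * (n : ℝ) ^ (2 * M - 1) * n + 2 ^ (2 * M - 1))
    with hB
  refine ⟨(J + B * v).toNNReal, fun f A R s hR hs hAs hA hAM hf hfM => ?_⟩
  rw [ENNReal.coe_toNNReal (ENNReal.add_ne_top.2 ⟨hJt, ENNReal.mul_ne_top ENNReal.coe_ne_top hvt⟩)]
  set G : Fin n → SchwartzMap (Rn n) ℂ :=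
    fun i => ∂^{fun _ : Fin M => (EuclideanSpace.single i (1 : ℝ) : Rn n)} f with hG
  have hGA (i : Fin n) (ξ : Rn n) : ‖G i ξ‖ ≤ A := by
    rw [hG, iteratedLineDerivOp_eq_iteratedFDeriv]
    refine (ContinuousMultilinearMap.le_opNorm _ _).trans ?_
    simpa using hAM ξ
  have hG0 (i : Fin n) (ξ : Rn n) (h : R < ‖ξ‖) : G i ξ = 0 := by
    rw [hG, iteratedLineDerivOp_eq_iteratedFDeriv, hfM ξ h]
    rfl
  have hL2 (g : SchwartzMap (Rn n) ℂ) (h1 : ∀ ξ, ‖g ξ‖ ≤ A) (h2 : ∀ ξ, R < ‖ξ‖ → g ξ = 0) :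
      ∫⁻ w, ENNReal.ofReal (‖𝓕 g w‖ ^ 2) ≤ ENNReal.ofReal (s ^ 2) * v :=
    (lintegral_sq_fourier_le g hR h1 h2).trans (by gcongr)
  have hpt (w : Rn n) : (1 + ‖(2 * π) • w‖) ^ (n + 1) * ‖𝓕 f w‖ ≤
      s * (1 + ‖w‖) ^ (-(M : ℝ)) + s⁻¹ * (2 ^ (2 * M - 1) * ‖𝓕 f w‖ ^ 2 +
        2 ^ (2 * M - 1) * (n : ℝ) ^ (2 * M - 1) * ∑ i, ‖𝓕 (G i) w‖ ^ 2) := by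
    set p := 1 + ‖(2 * π) • w‖ with hp
    have hp1 : 1 ≤ p := by rw [hp]; linarith [norm_nonneg ((2 * π) • w)]
    have hp2 : 1 + ‖w‖ ≤ p := by
      rw [hp, norm_smul, Real.norm_of_nonneg (by positivity)]
      nlinarith [norm_nonneg w, Real.pi_gt_three]
    set F := ‖𝓕 f w‖ with hF
    have hK : 2 * M - 1 + 1 = 2 * M := by omega
    have h1 : p ^ (2 * M) * F ^ 2 ≤ 2 ^ (2 * M - 1) * F ^ 2 +
        2 ^ (2 * M - 1) * (n : ℝ) ^ (2 * M - 1) * ∑ i, ‖𝓕 (G i) w‖ ^ 2 := by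
      have h := one_add_norm_pow_le hn (2 * M - 1) ((2 * π) • w)
      rw [hK] at h
      refine (mul_le_mul_of_nonneg_right h (sq_nonneg F)).trans (le_of_eq ?_)
      simp only [hG, norm_fourier_iteratedLineDeriv_const, mul_pow, ← pow_mul]
      rw [← Finset.sum_mul, mul_comm 2 M]
      ring
    have h2 : (p ^ M)⁻¹ ≤ (1 + ‖w‖) ^ (-(M : ℝ)) := by
      rw [Real.rpow_neg (by positivity), Real.rpow_natCast]
      gcongr
    have h3 : p ^ (n + 1) * F ≤ s * (p ^ M)⁻¹ + s⁻¹ * (p ^ (2 * M) * F ^ 2) := by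
      have hpM : p ^ M = p ^ (n + 1) * p ^ (n + 1) := by rw [hM]; ring
      have hp2M : p ^ (2 * M) = (p ^ (n + 1) * p ^ (n + 1)) * (p ^ (n + 1) * p ^ (n + 1)) := by
        rw [hM]; ring
      rw [hpM, hp2M]
      have hq : 0 < p ^ (n + 1) := by positivity
      generalize p ^ (n + 1) = q at hq
      have hF0 : 0 ≤ F := norm_nonneg _
      rw [← sub_nonneg]
      have : s * (q * q)⁻¹ + s⁻¹ * (q * q * (q * q) * F ^ 2) - q * F =
        ((s - q * q * q * F) ^ 2 + s * (q * q * q * F)) / (s * (q * q)) := by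
        field_simp
        ring
      rw [this]
      positivity
    calc p ^ (n + 1) * F ≤ s * (p ^ M)⁻¹ + s⁻¹ * (p ^ (2 * M) * F ^ 2) := h3
      _ ≤ _ := by gcongr
  calc ∫⁻ w, ENNReal.ofReal ((1 + ‖(2 * π) • w‖) ^ (n + 1) * ‖𝓕 f w‖)
      ≤ ∫⁻ w, (ENNReal.ofReal s * ENNReal.ofReal ((1 + ‖w‖) ^ (-(M : ℝ))) +
          ENNReal.ofReal s⁻¹ * (ENNReal.ofReal (2 ^ (2 * M - 1)) * ENNReal.ofReal (‖𝓕 f w‖ ^ 2) +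
          ENNReal.ofReal (2 ^ (2 * M - 1) * (n : ℝ) ^ (2 * M - 1)) *
            ∑ i, ENNReal.ofReal (‖𝓕 (G i) w‖ ^ 2))) := by
        refine lintegral_mono fun w => (ENNReal.ofReal_le_ofReal (hpt w)).trans (le_of_eq ?_)
        rw [← ENNReal.ofReal_sum_of_nonneg (fun _ _ => by positivity),
          ← ENNReal.ofReal_mul (by positivity), ← ENNReal.ofReal_mul (by positivity),
          ← ENNReal.ofReal_mul (by positivity), ← ENNReal.ofReal_add (by positivity) (by positivity),
          ← ENNReal.ofReal_mul (by positivity), ← ENNReal.ofReal_add (by positivity) (by positivity)]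
    _ = ENNReal.ofReal s * J + ENNReal.ofReal s⁻¹ * (ENNReal.ofReal (2 ^ (2 * M - 1)) *
          (∫⁻ w, ENNReal.ofReal (‖𝓕 f w‖ ^ 2)) +
          ENNReal.ofReal (2 ^ (2 * M - 1) * (n : ℝ) ^ (2 * M - 1)) *
            ∑ i, ∫⁻ w, ENNReal.ofReal (‖𝓕 (G i) w‖ ^ 2)) := by
        have hm (g : SchwartzMap (Rn n) ℂ) :
            Measurable fun w => ENNReal.ofReal (‖𝓕 g w‖ ^ 2) :=
          ((𝓕 g).continuous.norm.pow 2).measurable.ennreal_ofReal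
        have hms : Measurable fun w => ∑ i, ENNReal.ofReal (‖𝓕 (G i) w‖ ^ 2) :=
          Finset.measurable_sum _ fun i _ => hm (G i)
        have hmt : Measurable fun w =>
            ENNReal.ofReal (2 ^ (2 * M - 1)) * ENNReal.ofReal (‖𝓕 f w‖ ^ 2) +
            ENNReal.ofReal (2 ^ (2 * M - 1) * (n : ℝ) ^ (2 * M - 1)) *
              ∑ i, ENNReal.ofReal (‖𝓕 (G i) w‖ ^ 2) :=
          ((hm f).const_mul _).add (hms.const_mul _)
        rw [lintegral_add_left (by fun_prop), lintegral_const_mul _ (by fun_prop),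
          lintegral_const_mul _ hmt,
          lintegral_add_left ((hm f).const_mul _), lintegral_const_mul _ (hm f),
          lintegral_const_mul _ hms, lintegral_finsetSum _ fun i _ => hm (G i)]
    _ ≤ ENNReal.ofReal s * J + ENNReal.ofReal s⁻¹ * (ENNReal.ofReal (2 ^ (2 * M - 1)) *
          (ENNReal.ofReal (s ^ 2) * v) +
          ENNReal.ofReal (2 ^ (2 * M - 1) * (n : ℝ) ^ (2 * M - 1)) *
            ∑ _i : Fin n, (ENNReal.ofReal (s ^ 2) * v)) := by
        gcongr with i
        · exact hL2 f hA hf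
        · exact hL2 (G i) (hGA i) (hG0 i)
    _ = (J + B * v) * ENNReal.ofReal s := by
        have e1 : ENNReal.ofReal s⁻¹ * ENNReal.ofReal (s ^ 2) = ENNReal.ofReal s := by
          rw [← ENNReal.ofReal_mul (by positivity)]
          congr 1
          field_simp
        have e2 : (B : ℝ≥0∞) = ENNReal.ofReal (2 ^ (2 * M - 1) * (n : ℝ) ^ (2 * M - 1)) * n +
            ENNReal.ofReal (2 ^ (2 * M - 1)) := by
          rw [← ENNReal.ofReal_natCast n, ← ENNReal.ofReal_mul (by positivity),
            ← ENNReal.ofReal_add (by positivity) (by positivity)]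
          rfl
        rw [Finset.sum_const, Finset.card_univ, Fintype.card_fin, nsmul_eq_mul, e2]
        calc _ = ENNReal.ofReal s * J + (ENNReal.ofReal s⁻¹ * ENNReal.ofReal (s ^ 2)) *
              ((ENNReal.ofReal (2 ^ (2 * M - 1) * (n : ℝ) ^ (2 * M - 1)) * n +
            ENNReal.ofReal (2 ^ (2 * M - 1))) * v) := by ring
          _ = _ := by rw [e1]; ring

open SchwartzMap FourierTransform in
/-- Weighted `L¹` bound for the oscillatory integral `z ↦ ∫ e^{i⟨z,ξ⟩} f(ξ) dξ`. -/
theorem exists_lintegral_weight_oscillatory_le {n : ℕ} (hn : 1 ≤ n) :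
    ∃ c : ℝ≥0, ∀ (f : Rn n → ℂ) (A R s : ℝ), 0 ≤ R → 0 < s →
      A ^ 2 * R ^ n ≤ s ^ 2 → ContDiff ℝ (⊤ : ℕ∞) f → (∀ ξ, R < ‖ξ‖ → f ξ = 0) →
      (∀ ξ, ‖f ξ‖ ≤ A) → (∀ ξ, ‖iteratedFDeriv ℝ (2 * (n + 1)) f ξ‖ ≤ A) →
      ∫⁻ z : Rn n, ENNReal.ofReal ((1 + ‖z‖) ^ (n + 1)) *
        ‖∫ ξ : Rn n, Complex.exp (Complex.I * ((⟪z, ξ⟫_ℝ : ℝ) : ℂ)) * f ξ‖ₑ ≤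
          c * ENNReal.ofReal s := by
  obtain ⟨c, hc⟩ := exists_lintegral_weight_fourier_le hn
  set r : ℝ := -(2 * π)⁻¹ with hr
  have hr0 : r ≠ 0 := by rw [hr]; exact neg_ne_zero.2 (by positivity)
  refine ⟨Real.toNNReal |(r ^ n)⁻¹| * c, fun f A R s hR hs hAs hf hfR hA hAM => ?_⟩
  have hsub : tsupport f ⊆ Metric.closedBall 0 R := by
    refine closure_minimal (fun ξ hξ => ?_) Metric.isClosed_closedBall
    by_contra h
    exact hξ (hfR ξ (by simpa using h))
  have hcs : HasCompactSupport f :=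
    (isCompact_closedBall (0 : Rn n) R).of_isClosed_subset (isClosed_tsupport f) hsub
  set g : SchwartzMap (Rn n) ℂ := hcs.toSchwartzMap hf with hg
  have hgf : (g : Rn n → ℂ) = f := rfl
  have h0 (ξ : Rn n) (h : R < ‖ξ‖) : iteratedFDeriv ℝ (2 * (n + 1)) f ξ = 0 := by
    by_contra h'
    have := hsub (support_iteratedFDeriv_subset (𝕜 := ℝ) (2 * (n + 1)) h')
    rw [mem_closedBall_zero_iff] at this
    linarith
  have key := hc g A R s hR hs hAs hA hAM hfR h0
  set H : Rn n → ℝ≥0∞ :=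
    fun w => ENNReal.ofReal ((1 + ‖(2 * π) • w‖) ^ (n + 1) * ‖𝓕 g w‖) with hH
  have hHm : Measurable H := by
    have : Continuous fun w => 𝓕 g w := (𝓕 g).continuous
    refine (Continuous.measurable ?_).ennreal_ofReal
    fun_prop
  have hpt (z : Rn n) : ENNReal.ofReal ((1 + ‖z‖) ^ (n + 1)) *
      ‖∫ ξ : Rn n, Complex.exp (Complex.I * ((⟪z, ξ⟫_ℝ : ℝ) : ℂ)) * f ξ‖ₑ = H (r • z) := by
    have e1 : (2 * π) • r • z = -z := by
      rw [smul_smul, hr, mul_neg, mul_inv_cancel₀ (by positivity), neg_one_smul]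
    have e2 : ∫ ξ : Rn n, Complex.exp (Complex.I * ((⟪z, ξ⟫_ℝ : ℝ) : ℂ)) * f ξ =
        𝓕 g (r • z) := by
      rw [fourier_coe, Real.fourier_eq']
      refine integral_congr_ae (.of_forall fun ξ => ?_)
      simp only [smul_eq_mul, hgf]
      congr 2
      rw [real_inner_smul_right, real_inner_comm, hr, mul_comm]
      congr 2
      field_simp
    rw [hH, e2]
    simp only [e1, norm_neg]
    rw [ENNReal.ofReal_mul (by positivity), ofReal_norm]
  calc _ = ∫⁻ z, H (r • z) := lintegral_congr hpt
    _ = ∫⁻ w, H w ∂(Measure.map (r • ·) volume) :=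
        (lintegral_map hHm (measurable_const_smul r)).symm
    _ = ENNReal.ofReal |(r ^ n)⁻¹| * ∫⁻ w, H w := by
        rw [Measure.map_addHaar_smul _ hr0, lintegral_smul_measure, finrank_euclideanSpace_fin,
          smul_eq_mul]
    _ ≤ ENNReal.ofReal |(r ^ n)⁻¹| * (c * ENNReal.ofReal s) := by gcongr
    _ = _ := by
        rw [ENNReal.coe_mul, mul_assoc]
        rfl

theorem abs_apply_le_norm {n : ℕ} (z : Rn n) (i : Fin n) : |z i| ≤ ‖z‖ := by
  simpa using PiLp.norm_apply_le z i

theorem lintegral_cube_le_mHL {n : ℕ} (u : Rn n → ℂ) (x₀ : Rn n) {L : ℝ} (hL : 0 < L) :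
    ∫⁻ y in cube x₀ L, ‖u y‖ₑ ≤ ENNReal.ofReal (L ^ n) * mHL u x₀ := by
  have hx : x₀ ∈ cube x₀ L := fun i => by simp; positivity
  have h : (∫⁻ y in cube x₀ L, ‖u y‖ₑ) / ENNReal.ofReal (L ^ n) ≤ mHL u x₀ :=
    le_iSup_of_le x₀ (le_iSup_of_le L (le_iSup_of_le hL (le_iSup_of_le hx le_rfl)))
  rwa [ENNReal.div_le_iff (by simpa using pow_pos hL n) ENNReal.ofReal_ne_top, mul_comm] at h

/-- The maximal function controls averages against the decreasing profile
`(1 + |y - x₀| / l)^{-(n+1)}`. -/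
theorem lintegral_mul_weight_le_mHL {n : ℕ} {u : Rn n → ℂ} (hu : Continuous u) (x₀ : Rn n)
    {l : ℝ} (hl : 0 < l) :
    ∫⁻ y, ‖u y‖ₑ * ENNReal.ofReal (((1 + ‖y - x₀‖ / l) ^ (n + 1))⁻¹) ≤
      ENNReal.ofReal (2 ^ (2 * n + 2)) * ENNReal.ofReal (l ^ n) * mHL u x₀ := by
  set S : ℕ → Set (Rn n) := fun k => Metric.closedBall x₀ (2 ^ k * l) with hS
  have hSm (k : ℕ) : MeasurableSet (S k) := Metric.isClosed_closedBall.measurableSet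
  have hSc (k : ℕ) : S k ⊆ cube x₀ (2 * 2 ^ k * l) := fun y hy i => by
    rw [hS, mem_closedBall_iff_norm] at hy
    have := abs_apply_le_norm (y - x₀) i
    simp only [PiLp.sub_apply] at this
    linarith
  have hpt (y : Rn n) : ‖u y‖ₑ * ENNReal.ofReal (((1 + ‖y - x₀‖ / l) ^ (n + 1))⁻¹) ≤
      ∑' k : ℕ, ENNReal.ofReal ((2 / 2 ^ k) ^ (n + 1)) * (S k).indicator (fun y => ‖u y‖ₑ) y := by
    set t := ‖y - x₀‖ / l with ht
    have ht0 : 0 ≤ t := by positivity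
    obtain ⟨m, hm1, hm2⟩ := exists_nat_pow_near (x := 1 + t) (by linarith) one_lt_two
    have hy : y ∈ S (m + 1) := by
      rw [hS, mem_closedBall_iff_norm, ← div_le_iff₀ hl]
      linarith
    refine le_trans ?_ (ENNReal.le_tsum (m + 1))
    rw [Set.indicator_of_mem hy, mul_comm]
    gcongr
    rw [← inv_pow]
    gcongr
    rw [inv_le_comm₀ (by positivity) (by positivity), inv_div, pow_succ]
    linarith
  calc _ ≤ ∫⁻ y, ∑' k : ℕ, ENNReal.ofReal ((2 / 2 ^ k) ^ (n + 1)) *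
            (S k).indicator (fun y => ‖u y‖ₑ) y := lintegral_mono hpt
    _ = ∑' k : ℕ, ENNReal.ofReal ((2 / 2 ^ k) ^ (n + 1)) * ∫⁻ y in S k, ‖u y‖ₑ := by
        have hm (k : ℕ) : Measurable ((S k).indicator fun y => ‖u y‖ₑ) :=
          hu.measurable.enorm.indicator (hSm k)
        rw [lintegral_tsum fun k => ((hm k).const_mul _).aemeasurable]
        refine tsum_congr fun k => ?_
        rw [lintegral_const_mul _ (hm k), lintegral_indicator (hSm k)]
    _ ≤ ∑' k : ℕ, ENNReal.ofReal (2 ^ (2 * n + 1) * l ^ n) * mHL u x₀ * 2⁻¹ ^ k := by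
        refine ENNReal.tsum_le_tsum fun k => ?_
        calc _ ≤ ENNReal.ofReal ((2 / 2 ^ k) ^ (n + 1)) *
              (ENNReal.ofReal ((2 * 2 ^ k * l) ^ n) * mHL u x₀) := by
              gcongr
              exact (lintegral_mono_set (hSc k)).trans
                (lintegral_cube_le_mHL u x₀ (by positivity))
          _ = ENNReal.ofReal (2 ^ (2 * n + 1) * l ^ n * 2⁻¹ ^ k) * mHL u x₀ := by
              rw [← mul_assoc, ← ENNReal.ofReal_mul (by positivity)]
              congr 2
              rw [div_pow, mul_pow, mul_pow, inv_pow]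
              field_simp
              ring
          _ = _ := by
              rw [ENNReal.ofReal_mul (by positivity), ENNReal.ofReal_pow (by positivity) k,
                ENNReal.ofReal_inv_of_pos two_pos, ENNReal.ofReal_ofNat]
              ring
    _ = _ := by
        rw [ENNReal.tsum_mul_left, ENNReal.tsum_geometric, ENNReal.one_sub_inv_two, inv_inv,
          mul_right_comm, ← ENNReal.ofReal_ofNat 2, ← ENNReal.ofReal_mul (by positivity),
          ← ENNReal.ofReal_mul (by positivity)]
        congr 2
        ring

/-- The bounds defining the rough class hold for almost every `x`, simultaneously in `ξ`. -/
theorem RoughClass.exists_ae_forall_norm_iteratedFDeriv_le {n : ℕ} {m ϱ : ℝ}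
    {a : Rn n → Rn n → ℂ} (ha : RoughClass m ϱ a) (k : ℕ) :
    ∃ C : ℝ, 0 < C ∧ ∀ᵐ x : Rn n, ∀ ξ : Rn n,
      ‖iteratedFDeriv ℝ k (a x) ξ‖ ≤ C * (1 + ‖ξ‖ ^ 2) ^ ((m - ϱ * k) / 2) := by
  obtain ⟨C, hC, h⟩ := ha.2.2 k
  refine ⟨C, hC, ?_⟩
  have hd : ∀ᵐ x : Rn n, ∀ i : ℕ, ‖iteratedFDeriv ℝ k (a x) (TopologicalSpace.denseSeq (Rn n) i)‖ ≤
      C * (1 + ‖TopologicalSpace.denseSeq (Rn n) i‖ ^ 2) ^ ((m - ϱ * k) / 2) :=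
    ae_all_iff.2 fun i => h _
  filter_upwards [hd] with x hx ξ
  have hc1 : Continuous fun ξ => ‖iteratedFDeriv ℝ k (a x) ξ‖ :=
    ((ha.1 x).continuous_iteratedFDeriv (mod_cast le_top)).norm
  have hc2 : Continuous fun ξ : Rn n => C * (1 + ‖ξ‖ ^ 2) ^ ((m - ϱ * k) / 2) :=
    continuous_const.mul ((by fun_prop : Continuous fun ξ : Rn n => 1 + ‖ξ‖ ^ 2).rpow_const
      fun ξ => Or.inl (by positivity))
  have hcl : IsClosed {ξ : Rn n | ‖iteratedFDeriv ℝ k (a x) ξ‖ ≤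
      C * (1 + ‖ξ‖ ^ 2) ^ ((m - ϱ * k) / 2)} := isClosed_le hc1 hc2
  have hsub := closure_minimal (Set.range_subset_iff.2 hx) hcl
  rw [(TopologicalSpace.denseRange_denseSeq (Rn n)).closure_range] at hsub
  exact hsub (Set.mem_univ ξ)

/-- Derivative bounds for the localized symbol `a(x,ξ) ψ(2^{-j}ξ)`. -/
theorem RoughClass.exists_ae_norm_iteratedFDeriv_localized_le {n : ℕ}
    {a : Rn n → Rn n → ℂ} (ha : RoughClass (-(n : ℝ)) 0 a) {C₀ : ℝ} (hC₀ : 1 < C₀)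
    {ψ : Rn n → ℝ} (hψ : LPcut C₀ ψ) (k : ℕ) :
    ∃ A : ℝ, 0 ≤ A ∧ ∀ᵐ x : Rn n, ∀ (j : ℕ) (ξ : Rn n),
      ‖iteratedFDeriv ℝ k (fun η => a x η * ((ψ ((((2 : ℝ) ^ j)⁻¹) • η) : ℝ) : ℂ)) ξ‖ ≤
        A * ((2 ^ j) ^ n)⁻¹ := by
  obtain ⟨hψs, hψc, -, -, hψsupp⟩ := hψ
  choose C hC hCa using ha.exists_ae_forall_norm_iteratedFDeriv_le
  set Ψ : Rn n → ℂ := fun ξ => (ψ ξ : ℂ) with hΨ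
  have hΨs : ContDiff ℝ (⊤ : ℕ∞) Ψ := Complex.ofRealCLM.contDiff.comp hψs
  have hΨt : tsupport Ψ ⊆ tsupport ψ := closure_mono fun ξ hξ h => hξ (by simp [hΨ, h])
  have hΨc : HasCompactSupport Ψ := hψc.of_isClosed_subset (isClosed_tsupport Ψ) hΨt
  have hB (i : ℕ) : ∃ B, ∀ ξ, ‖iteratedFDeriv ℝ i Ψ ξ‖ ≤ B :=
    (hΨc.iteratedFDeriv i).exists_bound_of_continuous
      (hΨs.continuous_iteratedFDeriv (mod_cast le_top))
  choose B hB using hB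
  have hB0 (i : ℕ) : 0 ≤ B i := (norm_nonneg _).trans (hB i 0)
  refine ⟨∑ i ∈ Finset.range (k + 1), (k.choose i : ℝ) * (C i * C₀ ^ n) * B (k - i),
    Finset.sum_nonneg fun i _ => mul_nonneg (mul_nonneg (by positivity)
      (mul_nonneg (hC i).le (by positivity))) (hB0 _), ?_⟩
  filter_upwards [ae_all_iff.2 hCa] with x hx j ξ
  set r : ℝ := ((2 : ℝ) ^ j)⁻¹ with hr
  have hr0 : 0 < r := by positivity
  have hr1 : r ≤ 1 := inv_le_one_of_one_le₀ (one_le_pow₀ one_le_two)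
  have hΨj : ContDiff ℝ (⊤ : ℕ∞) fun η => Ψ (r • η) := hΨs.comp (contDiff_const_smul r)
  have hD (i : ℕ) : iteratedFDeriv ℝ i (fun η => Ψ (r • η)) ξ =
      r ^ i • iteratedFDeriv ℝ i Ψ (r • ξ) := by
    rw [iteratedFDeriv_comp_const_smul r (hΨs.of_le (mod_cast le_top) : ContDiff ℝ i Ψ)]
  refine (norm_iteratedFDeriv_mul_le (ha.1 x) hΨj ξ (n := k) (mod_cast le_top)).trans ?_
  rw [Finset.sum_mul]
  refine Finset.sum_le_sum fun i _ => ?_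
  by_cases hξ : r • ξ ∈ tsupport Ψ
  · have h1 : C₀⁻¹ * 2 ^ j ≤ ‖ξ‖ := by
      have := (hψsupp (hΨt hξ)).1
      rw [norm_smul, Real.norm_of_nonneg hr0.le, hr, inv_mul_eq_div,
        le_div_iff₀ (by positivity)] at this
      exact this
    have hpos : 0 < C₀⁻¹ * 2 ^ j := by positivity
    have h2 : (1 + ‖ξ‖ ^ 2) ^ ((-(n : ℝ) - 0 * i) / 2) ≤ C₀ ^ n * ((2 ^ j) ^ n)⁻¹ := by
      calc (1 + ‖ξ‖ ^ 2) ^ ((-(n : ℝ) - 0 * i) / 2)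
          ≤ ((C₀⁻¹ * 2 ^ j) ^ 2) ^ ((-(n : ℝ) - 0 * i) / 2) := by
            refine Real.rpow_le_rpow_of_nonpos (by positivity) ?_ ?_
            · have := pow_le_pow_left₀ hpos.le h1 2
              linarith
            · have : (0 : ℝ) ≤ n := n.cast_nonneg
              linarith
        _ = ((C₀⁻¹ * 2 ^ j) ^ n)⁻¹ := by
            rw [← Real.rpow_natCast (C₀⁻¹ * 2 ^ j) 2, ← Real.rpow_mul hpos.le,
              ← Real.rpow_natCast (C₀⁻¹ * 2 ^ j) n, ← Real.rpow_neg hpos.le]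
            congr 1
            push_cast
            ring
        _ = C₀ ^ n * ((2 ^ j) ^ n)⁻¹ := by
            rw [mul_pow, mul_inv, inv_pow, inv_inv]
    have h3 : ‖iteratedFDeriv ℝ i (a x) ξ‖ ≤ C i * C₀ ^ n * ((2 ^ j) ^ n)⁻¹ := by
      rw [mul_assoc]
      exact (hx i ξ).trans (mul_le_mul_of_nonneg_left h2 (hC i).le)
    have h4 : ‖iteratedFDeriv ℝ (k - i) (fun η => Ψ (r • η)) ξ‖ ≤ B (k - i) := by
      rw [hD, norm_smul, norm_pow, Real.norm_of_nonneg hr0.le]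
      exact (mul_le_of_le_one_left (norm_nonneg _) (pow_le_one₀ hr0.le hr1)).trans (hB _ _)
    have hCi := hC i
    calc _ ≤ (k.choose i : ℝ) * (C i * C₀ ^ n * ((2 ^ j) ^ n)⁻¹) * B (k - i) := by gcongr
      _ = _ := by ring
  · have h0 : iteratedFDeriv ℝ (k - i) Ψ (r • ξ) = 0 := by
      by_contra h
      exact hξ (support_iteratedFDeriv_subset (𝕜 := ℝ) (k - i) h)
    rw [hD, h0, smul_zero, norm_zero, mul_zero]
    have := hC i
    have := hB0 (k - i)
    positivity

/-- The dual kernels are jointly measurable. -/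
theorem RoughClass.measurable_KjStar {n : ℕ} {m ϱ : ℝ} {a : Rn n → Rn n → ℂ}
    (ha : RoughClass m ϱ a) {ψ : Rn n → ℝ} (hψ : Continuous ψ) (j : ℕ) :
    Measurable (Function.uncurry (KjStar a ψ j)) := by
  have h1 : Measurable fun p : Rn n × Rn n => a p.2 p.1 :=
    measurable_uncurry_of_continuous_of_measurable (u := fun ξ y => a y ξ)
      (fun y => (ha.1 y).continuous) ha.2.1
  have h2 : Measurable fun q : (Rn n × Rn n) × Rn n => a q.1.2 q.2 :=
    h1.comp (measurable_snd.prodMk (measurable_snd.comp measurable_fst))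
  have h3 : Continuous fun q : (Rn n × Rn n) × Rn n =>
      Complex.exp (Complex.I * ((⟪q.1.1 - q.1.2, q.2⟫_ℝ : ℝ) : ℂ)) := by fun_prop
  have h4 : Continuous fun q : (Rn n × Rn n) × Rn n =>
      ((ψ ((((2 : ℝ) ^ j)⁻¹) • q.2) : ℝ) : ℂ) := by fun_prop
  have h5 := (((h3.measurable.mul h2).mul h4.measurable).stronglyMeasurable).integral_prod_right'
    (ν := (volume : Measure (Rn n)))
  exact h5.measurable.const_mul _

theorem measurableSet_cube {n : ℕ} (x₀ : Rn n) (l : ℝ) : MeasurableSet (cube x₀ l) := by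
  have : cube x₀ l = ⋂ i, {y : Rn n | |y i - x₀ i| ≤ l / 2} := by
    ext y
    simp [cube]
  rw [this]
  refine MeasurableSet.iInter fun i => (isClosed_le ?_ continuous_const).measurableSet
  fun_prop

/-- Points of a cube of side `l` lie within `n l` of its center. -/
theorem norm_sub_le_of_mem_cube {n : ℕ} {x x₀ : Rn n} {l : ℝ} (hl : 0 ≤ l)
    (hx : x ∈ cube x₀ l) : ‖x - x₀‖ ≤ n * l := by
  rw [EuclideanSpace.norm_eq, Real.sqrt_le_left (by positivity)]
  calc ∑ i, ‖(x - x₀) i‖ ^ 2 ≤ ∑ _i : Fin n, l ^ 2 := by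
        gcongr with i
        rw [PiLp.sub_apply, Real.norm_eq_abs]
        linarith [hx i]
    _ = n * l ^ 2 := by simp
    _ ≤ (n * l) ^ 2 := by
        rw [mul_pow]
        gcongr
        exact_mod_cast Nat.le_self_pow two_ne_zero n

/-- For almost every `y`, the mass of `K_j^*(·, y)` on a cube is `O(2^{-jn/2})` and decays away from
the cube at the scale of the side length. -/
theorem RoughClass.exists_ae_lintegral_cube_KjStar_le {n : ℕ} (hn : 1 ≤ n)
    {a : Rn n → Rn n → ℂ} (ha : RoughClass (-(n : ℝ)) 0 a) {C₀ : ℝ} (hC₀ : 1 < C₀)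
    {ψ : Rn n → ℝ} (hψ : LPcut C₀ ψ) :
    ∃ C : ℝ≥0, ∀ᵐ y : Rn n, ∀ (j : ℕ) (l : ℝ), 1 ≤ l → ∀ x₀ : Rn n,
      ∫⁻ x in cube x₀ l, ‖KjStar a ψ j x y‖ₑ ≤
        C * ENNReal.ofReal ((2 : ℝ) ^ (-((j : ℝ) * n) / 2)) *
          ENNReal.ofReal (((1 + ‖y - x₀‖ / l) ^ (n + 1))⁻¹) := by
  obtain ⟨c, hc⟩ := exists_lintegral_weight_oscillatory_le hn
  obtain ⟨A₁, hA₁, h₁⟩ := ha.exists_ae_norm_iteratedFDeriv_localized_le hC₀ hψ 0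
  obtain ⟨A₂, hA₂, h₂⟩ := ha.exists_ae_norm_iteratedFDeriv_localized_le hC₀ hψ (2 * (n + 1))
  set A := A₁ + A₂ + 1 with hA
  have hA0 : 0 < A := by positivity
  set D := A * (2 * C₀) ^ n with hD
  have hD0 : 0 < D := by positivity
  refine ⟨Real.toNNReal ((n + 1) ^ (n + 1)) * c * Real.toNNReal D, ?_⟩
  filter_upwards [h₁, h₂] with y hy₁ hy₂ j l hl x₀
  set q : ℝ := (2 : ℝ) ^ (-((j : ℝ) * n) / 2) with hq
  have hq0 : 0 < q := by positivity
  have hq2 : q ^ 2 = ((2 ^ j) ^ n)⁻¹ := by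
    rw [hq, ← Real.rpow_natCast, ← Real.rpow_mul two_pos.le, ← pow_mul, ← Real.rpow_natCast,
      ← Real.rpow_neg two_pos.le]
    congr 1
    push_cast
    ring
  set f : Rn n → ℂ := fun ξ => a y ξ * ((ψ ((((2 : ℝ) ^ j)⁻¹) • ξ) : ℝ) : ℂ) with hf
  have hfs : ContDiff ℝ (⊤ : ℕ∞) f :=
    (ha.1 y).mul (Complex.ofRealCLM.contDiff.comp (hψ.1.comp (contDiff_const_smul _)))
  have hf0 (ξ : Rn n) (h : 2 * C₀ * 2 ^ j < ‖ξ‖) : f ξ = 0 := by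
    have : ψ ((((2 : ℝ) ^ j)⁻¹) • ξ) = 0 := by
      refine image_eq_zero_of_notMem_tsupport fun hmem => ?_
      have h' := (hψ.2.2.2.2 hmem).2
      rw [norm_smul, norm_inv, norm_pow, Real.norm_ofNat, inv_mul_le_iff₀ (by positivity)] at h'
      linarith
    simp [hf, this]
  have hinv : 0 ≤ ((2 ^ j) ^ n : ℝ)⁻¹ := by positivity
  have hfA (ξ : Rn n) : ‖f ξ‖ ≤ A * ((2 ^ j) ^ n)⁻¹ := by
    have h := hy₁ j ξ
    rw [norm_iteratedFDeriv_zero] at h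
    exact h.trans (mul_le_mul_of_nonneg_right (by linarith) hinv)
  have hfA' (ξ : Rn n) : ‖iteratedFDeriv ℝ (2 * (n + 1)) f ξ‖ ≤ A * ((2 ^ j) ^ n)⁻¹ :=
    (hy₂ j ξ).trans (mul_le_mul_of_nonneg_right (by linarith) hinv)
  have hAs : (A * ((2 ^ j) ^ n)⁻¹) ^ 2 * (2 * C₀ * 2 ^ j) ^ n ≤ (D * q) ^ 2 := by
    have h1 : (1 : ℝ) ≤ (2 * C₀) ^ n := one_le_pow₀ (by linarith)
    calc (A * ((2 ^ j) ^ n)⁻¹) ^ 2 * (2 * C₀ * 2 ^ j) ^ n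
        = A ^ 2 * (2 * C₀) ^ n * ((2 ^ j) ^ n)⁻¹ := by
          rw [mul_pow (2 * C₀)]
          field_simp
      _ ≤ A ^ 2 * ((2 * C₀) ^ n * (2 * C₀) ^ n) * ((2 ^ j) ^ n)⁻¹ := by
          gcongr
          exact le_mul_of_one_le_left (by positivity) h1
      _ = (D * q) ^ 2 := by rw [mul_pow D q, hq2, hD]; ring
  have key := hc f _ _ (D * q) (by positivity) (by positivity) hAs hfs hf0 hfA hfA'
  set w : ℝ := ((1 + ‖y - x₀‖ / l) ^ (n + 1))⁻¹ with hw
  set F : Rn n → ℂ :=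
    fun z => ∫ ξ : Rn n, Complex.exp (Complex.I * ((⟪z, ξ⟫_ℝ : ℝ) : ℂ)) * f ξ with hF
  have hK (x : Rn n) : ‖KjStar a ψ j x y‖ₑ ≤ ‖F (x - y)‖ₑ := by
    have e : KjStar a ψ j x y = ((((2 * π) ^ n)⁻¹ : ℝ) : ℂ) * F (x - y) := by
      simp only [KjStar, hF, hf, mul_assoc]
    rw [e, enorm_le_iff_norm_le, norm_mul, Complex.norm_real, Real.norm_of_nonneg (by positivity)]
    refine mul_le_of_le_one_left (norm_nonneg _) (inv_le_one_of_one_le₀ (one_le_pow₀ ?_))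
    linarith [Real.pi_gt_three]
  have hwt (x : Rn n) (hx : x ∈ cube x₀ l) :
      1 ≤ (n + 1) ^ (n + 1) * w * (1 + ‖x - y‖) ^ (n + 1) := by
    have hl0 : 0 < l := by linarith
    have h1 : ‖y - x₀‖ ≤ ‖x - y‖ + n * l := by
      have := norm_sub_le_of_mem_cube hl0.le hx
      calc ‖y - x₀‖ = ‖(x - x₀) - (x - y)‖ := by congr 1; abel
        _ ≤ _ := (norm_sub_le _ _).trans (by linarith)
    have h2 : 1 + ‖y - x₀‖ / l ≤ (n + 1) * (1 + ‖x - y‖) := by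
      have h3 : ‖y - x₀‖ / l ≤ ‖x - y‖ + n := by
        rw [div_le_iff₀ hl0]
        nlinarith [norm_nonneg (x - y)]
      have : 0 ≤ (n : ℝ) * ‖x - y‖ := by positivity
      linarith
    have h4 : 0 < (1 + ‖y - x₀‖ / l) ^ (n + 1) := by positivity
    rw [hw, mul_right_comm, ← mul_pow, ← div_eq_mul_inv, one_le_div h4]
    gcongr
  calc ∫⁻ x in cube x₀ l, ‖KjStar a ψ j x y‖ₑ
      ≤ ∫⁻ x in cube x₀ l, ENNReal.ofReal ((n + 1) ^ (n + 1) * w) *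
          (ENNReal.ofReal ((1 + ‖x - y‖) ^ (n + 1)) * ‖F (x - y)‖ₑ) := by
        refine setLIntegral_mono' (measurableSet_cube x₀ l) fun x hx => (hK x).trans ?_
        rw [← mul_assoc, ← ENNReal.ofReal_mul (by positivity)]
        refine le_mul_of_one_le_left zero_le ?_
        rw [← ENNReal.ofReal_one]
        exact ENNReal.ofReal_le_ofReal (hwt x hx)
    _ ≤ ∫⁻ x, ENNReal.ofReal ((n + 1) ^ (n + 1) * w) *
          (ENNReal.ofReal ((1 + ‖x - y‖) ^ (n + 1)) * ‖F (x - y)‖ₑ) :=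
        setLIntegral_le_lintegral _ _
    _ = ENNReal.ofReal ((n + 1) ^ (n + 1) * w) *
          ∫⁻ z, ENNReal.ofReal ((1 + ‖z‖) ^ (n + 1)) * ‖F z‖ₑ := by
        rw [lintegral_const_mul' _ _ ENNReal.ofReal_ne_top]
        congr 1
        exact lintegral_sub_right_eq_self
          (fun z => ENNReal.ofReal ((1 + ‖z‖) ^ (n + 1)) * ‖F z‖ₑ) y
    _ ≤ ENNReal.ofReal ((n + 1) ^ (n + 1) * w) * (c * ENNReal.ofReal (D * q)) := by gcongr
    _ = _ := by
        rw [ENNReal.ofReal_mul (by positivity), ENNReal.ofReal_mul hD0.le, ENNReal.coe_mul,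
          ENNReal.coe_mul]
        change _ = ENNReal.ofReal ((n + 1) ^ (n + 1)) * c * ENNReal.ofReal D * _ * _
        ring

/-- The sharper estimate, in which only the factor `2^{-jn/2}` appears. -/
theorem RoughClass.exists_lintegral_cube_TjStar_le {n : ℕ} (hn : 1 ≤ n)
    {a : Rn n → Rn n → ℂ} (ha : RoughClass (-(n : ℝ)) 0 a) {C₀ : ℝ} (hC₀ : 1 < C₀)
    {ψ : Rn n → ℝ} (hψ : LPcut C₀ ψ) :
    ∃ C : ℝ≥0, ∀ (j : ℕ) (l : ℝ), 1 ≤ l → ∀ (x₀ : Rn n) (u : Rn n → ℂ), Continuous u →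
      ∫⁻ x in cube x₀ l, ‖TjStar a ψ j u x‖ₑ ≤
        C * ENNReal.ofReal ((2 : ℝ) ^ (-((j : ℝ) * n) / 2)) * ENNReal.ofReal (l ^ n) *
          mHL u x₀ := by
  obtain ⟨C, hC⟩ := ha.exists_ae_lintegral_cube_KjStar_le hn hC₀ hψ
  refine ⟨C * 2 ^ (2 * n + 2), fun j l hl x₀ u hu => ?_⟩
  set q := ENNReal.ofReal ((2 : ℝ) ^ (-((j : ℝ) * n) / 2)) with hq
  have hKm := ha.measurable_KjStar hψ.1.continuous j
  have hm : Measurable (Function.uncurry fun x y => ‖KjStar a ψ j x y‖ₑ * ‖u y‖ₑ) :=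
    hKm.enorm.mul (hu.measurable.comp measurable_snd).enorm
  calc ∫⁻ x in cube x₀ l, ‖TjStar a ψ j u x‖ₑ
      ≤ ∫⁻ x in cube x₀ l, ∫⁻ y, ‖KjStar a ψ j x y‖ₑ * ‖u y‖ₑ := by
        refine lintegral_mono fun x => (enorm_integral_le_lintegral_enorm _).trans (le_of_eq ?_)
        simp only [enorm_mul]
    _ = ∫⁻ y, ∫⁻ x in cube x₀ l, ‖KjStar a ψ j x y‖ₑ * ‖u y‖ₑ :=
        lintegral_lintegral_swap hm.aemeasurable
    _ = ∫⁻ y, (∫⁻ x in cube x₀ l, ‖KjStar a ψ j x y‖ₑ) * ‖u y‖ₑ :=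
        lintegral_congr fun y => lintegral_mul_const' _ _ enorm_ne_top
    _ ≤ ∫⁻ y, C * q * (‖u y‖ₑ * ENNReal.ofReal (((1 + ‖y - x₀‖ / l) ^ (n + 1))⁻¹)) := by
        refine lintegral_mono_ae ?_
        filter_upwards [hC] with y hy
        refine (mul_le_mul_left (hy j l hl x₀) _).trans (le_of_eq ?_)
        ring
    _ = C * q * ∫⁻ y, ‖u y‖ₑ * ENNReal.ofReal (((1 + ‖y - x₀‖ / l) ^ (n + 1))⁻¹) :=
        lintegral_const_mul' _ _ (ENNReal.mul_ne_top ENNReal.coe_ne_top ENNReal.ofReal_ne_top)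
    _ ≤ C * q * (ENNReal.ofReal (2 ^ (2 * n + 2)) * ENNReal.ofReal (l ^ n) * mHL u x₀) := by
        gcongr
        exact lintegral_mul_weight_le_mHL hu x₀ (by linarith)
    _ = _ := by
        rw [ENNReal.ofReal_pow two_pos.le, ENNReal.ofReal_ofNat]
        push_cast
        ring

/-- If `a ∈ L^∞S^{-n}_0`, `0 < θ₁ < n/2`, `ε > 0`, and `N > n` is a positive
integer, then for `l ≥ 1` and `j ≥ 1`:
`|Q(x₀,l)|⁻¹ ∫_{Q(x₀,l)} |T_j^* u| dx ≤
  C (2^{-jn/2+jθ₁+jεn} + 2^{-jε(N-n)} l^{-(N-n)}) Mu(x₀)`. -/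
theorem stmt15 (n : ℕ) (hn : 1 ≤ n)
    (a : Rn n → Rn n → ℂ) (ha : RoughClass (-(n : ℝ)) 0 a)
    (θ₁ : ℝ) (hθ₁0 : 0 < θ₁) (hθ₁1 : θ₁ < (n : ℝ) / 2)
    (ε : ℝ) (hε : 0 < ε) (N : ℕ) (hN : n < N)
    (C₀ : ℝ) (hC₀ : 1 < C₀) (ψ : Rn n → ℝ) (hψ : LPcut C₀ ψ) :
    ∃ C : ℝ, 0 < C ∧ ∀ l : ℝ, 1 ≤ l → ∀ j : ℕ, 1 ≤ j →
      ∀ x₀ : Rn n, ∀ u : SchwartzMap (Rn n) ℂ,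
        (∫⁻ x in cube x₀ l, (‖TjStar a ψ j (⇑u) x‖₊ : ℝ≥0∞)) / ENNReal.ofReal (l ^ n) ≤
          ENNReal.ofReal (C *
            ((2 : ℝ) ^ (-((j : ℝ) * n) / 2 + (j : ℝ) * θ₁ + (j : ℝ) * ε * n) +
              (2 : ℝ) ^ (-((j : ℝ) * ε) * ((N : ℝ) - n)) * l ^ (-((N : ℝ) - n)))) *
            mHL (⇑u) x₀ := by
  obtain ⟨C, hC⟩ := ha.exists_lintegral_cube_TjStar_le hn hC₀ hψ
  refine ⟨C + 1, by positivity, fun l hl j _ x₀ u => ?_⟩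
  have hl0 : 0 < l := by linarith
  rw [ENNReal.div_le_iff (by simpa using pow_pos hl0 n) ENNReal.ofReal_ne_top]
  refine (hC j l hl x₀ u u.continuous).trans ?_
  have hmono : (2 : ℝ) ^ (-((j : ℝ) * n) / 2) ≤
      (2 : ℝ) ^ (-((j : ℝ) * n) / 2 + (j : ℝ) * θ₁ + (j : ℝ) * ε * n) := by
    refine Real.rpow_le_rpow_of_exponent_le one_le_two ?_
    have h1 : 0 ≤ (j : ℝ) * θ₁ := by positivity
    have h2 : 0 ≤ (j : ℝ) * ε * n := by positivity
    linarith
  have hbound : (C : ℝ≥0∞) * ENNReal.ofReal ((2 : ℝ) ^ (-((j : ℝ) * n) / 2)) ≤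
      ENNReal.ofReal ((C + 1) *
        ((2 : ℝ) ^ (-((j : ℝ) * n) / 2 + (j : ℝ) * θ₁ + (j : ℝ) * ε * n) +
          (2 : ℝ) ^ (-((j : ℝ) * ε) * ((N : ℝ) - n)) * l ^ (-((N : ℝ) - n)))) := by
    rw [← ENNReal.ofReal_coe_nnreal, ← ENNReal.ofReal_mul C.coe_nonneg]
    refine ENNReal.ofReal_le_ofReal (mul_le_mul (by linarith) ?_ (by positivity) (by positivity))
    have : 0 ≤ (2 : ℝ) ^ (-((j : ℝ) * ε) * ((N : ℝ) - n)) * l ^ (-((N : ℝ) - n)) := by positivity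
    linarith
  rw [mul_right_comm]
  gcongr
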